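/- Assume π₁ = π₂ = π and that every stopping rule is truncatable, and let 𝓕 be the set of all stopping rules. Then a stopping rule ψ satisfies R(ψ) = inf_{ψ′ ∈ 𝓕} R(ψ′) if and only if, for every n ≥ 1, the inequalities 1{Rₙ < qₙ} ≤ ψₙ ≤ 1{Rₙ ≤ qₙ} hold almost everywhere with respect to the measure fⁿ·μⁿ on Tₙ^ψ = {tₙ^ψ > 0}, where Rₙ = lₙ/fⁿ is the posterior risk and qₙ = Qₙ/fⁿ = c + ∫ vₙ₊₁(x₁,…,xₙ,y) (fⁿ⁺¹(x₁,…,xₙ,y)/fⁿ(x₁,…,xₙ)) dμ(y) with vₙ = Vₙ/fⁿ. -/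

import Mathlib

open MeasureTheory ENNReal Filter ProbabilityTheory

namespace SDP

variable {Θ X D : Type*} [MeasurableSpace Θ] [MeasurableSpace X] [MeasurableSpace D]

/-- The product measure `μⁿ` on `Xⁿ`. -/
noncomputable def pm (μ : Measure X) (n : ℕ) : Measure (Fin n → X) :=
  Measure.pi fun _ => μ

/-- `t_n^ψ = (1-ψ₁)⋯(1-ψ_{n-1})`, with `t₁^ψ ≡ 1`. -/
noncomputable def t (ψ : ∀ n, (Fin n → X) → ℝ≥0∞) : ∀ n, (Fin n → X) → ℝ≥0∞
  | 0, _ => 1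
  | 1, _ => 1
  | n + 2, x => t ψ (n + 1) (Fin.init x) * (1 - ψ (n + 1) (Fin.init x))

/-- `s_n^ψ = (1-ψ₁)⋯(1-ψ_{n-1})ψ_n`. -/
noncomputable def s (ψ : ∀ n, (Fin n → X) → ℝ≥0∞) (n : ℕ) (x : Fin n → X) : ℝ≥0∞ :=
  t ψ n x * ψ n x

/-- A stopping rule: a sequence of measurable functions with values in `[0,1]`. -/
def IsStoppingRule (ψ : ∀ n, (Fin n → X) → ℝ≥0∞) : Prop :=
  (∀ n, Measurable (ψ n)) ∧ ∀ n x, ψ n x ≤ 1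

/-- A decision rule: a sequence of measurable functions with values in `D`. -/
def IsDecisionRule (δ : ∀ n, (Fin n → X) → D) : Prop := ∀ n, Measurable (δ n)

/-- `ψ` is truncated at `N`: `ψ_n ≡ 1` for all `n ≥ N`. -/
def TruncatedAt (ψ : ∀ n, (Fin n → X) → ℝ≥0∞) (N : ℕ) : Prop :=
  ∀ n, N ≤ n → ∀ x, ψ n x = 1

/-- A consistent family of joint probability densities `f_θⁿ` w.r.t. `μⁿ`. -/
def IsDensityFamily (μ : Measure X) (f : Θ → ∀ n, (Fin n → X) → ℝ≥0∞) : Prop :=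
  (∀ n, Measurable fun p : Θ × (Fin n → X) => f p.1 n p.2) ∧
  (∀ θ x, f θ 0 x = 1) ∧
  (∀ θ n, ∫⁻ x, f θ n x ∂pm μ n = 1) ∧
  ∀ θ n (x : Fin n → X), ∫⁻ y, f θ (n + 1) (Fin.snoc x y) ∂μ = f θ n x

/-- The average loss `W(ψ,δ)`. -/
noncomputable def W (π₁ : Measure Θ) (μ : Measure X) (w : Θ → D → ℝ≥0∞)
    (f : Θ → ∀ n, (Fin n → X) → ℝ≥0∞) (ψ : ∀ n, (Fin n → X) → ℝ≥0∞)
    (δ : ∀ n, (Fin n → X) → D) : ℝ≥0∞ :=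
  ∑' n : ℕ, ∫⁻ θ, ∫⁻ x, s ψ (n + 1) x * w θ (δ (n + 1) x) * f θ (n + 1) x ∂pm μ (n + 1) ∂π₁

/-- The partial average loss `W_i(ψ,δ)` (integration over `Θᵢ`). -/
noncomputable def Wi (π₁ : Measure Θ) (μ : Measure X) (w : Θ → D → ℝ≥0∞)
    (f : Θ → ∀ n, (Fin n → X) → ℝ≥0∞) (Θi : Set Θ) (ψ : ∀ n, (Fin n → X) → ℝ≥0∞)
    (δ : ∀ n, (Fin n → X) → D) : ℝ≥0∞ :=
  ∑' n : ℕ,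
    ∫⁻ θ in Θi, ∫⁻ x, s ψ (n + 1) x * w θ (δ (n + 1) x) * f θ (n + 1) x ∂pm μ (n + 1) ∂π₁

/-- `P^{π}(τ_ψ = n)`. -/
noncomputable def PtauEq (π₂ : Measure Θ) (μ : Measure X)
    (f : Θ → ∀ n, (Fin n → X) → ℝ≥0∞) (ψ : ∀ n, (Fin n → X) → ℝ≥0∞) (n : ℕ) : ℝ≥0∞ :=
  ∫⁻ θ, ∫⁻ x, s ψ n x * f θ n x ∂pm μ n ∂π₂

/-- `P^{π}(τ_ψ < ∞)`. -/
noncomputable def Pfin (π₂ : Measure Θ) (μ : Measure X)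
    (f : Θ → ∀ n, (Fin n → X) → ℝ≥0∞) (ψ : ∀ n, (Fin n → X) → ℝ≥0∞) : ℝ≥0∞ :=
  ∑' n : ℕ, PtauEq π₂ μ f ψ (n + 1)

/-- The average sample number `N(ψ)` (equal to `∞` if `P^{π₂}(τ_ψ < ∞) < 1`). -/
noncomputable def ASN (π₂ : Measure Θ) (μ : Measure X)
    (f : Θ → ∀ n, (Fin n → X) → ℝ≥0∞) (ψ : ∀ n, (Fin n → X) → ℝ≥0∞) : ℝ≥0∞ :=
  if Pfin π₂ μ f ψ = 1 then ∑' n : ℕ, ((n : ℝ≥0∞) + 1) * PtauEq π₂ μ f ψ (n + 1) else ⊤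

/-- `fⁿ = ∫_Θ f_θⁿ dπ₂(θ)` (in particular `f⁰ ≡ 1`). -/
noncomputable def fbar (π₂ : Measure Θ) (f : Θ → ∀ n, (Fin n → X) → ℝ≥0∞)
    (n : ℕ) (x : Fin n → X) : ℝ≥0∞ :=
  ∫⁻ θ, f θ n x ∂π₂

/-- `R(ψ) = Σₙ ∫ sₙ^ψ (c n fⁿ + lₙ) dμⁿ` if `P^{π₂}(τ_ψ<∞) = 1`, `∞` otherwise. -/
noncomputable def R (π₂ : Measure Θ) (μ : Measure X) (c : ℝ≥0∞)
    (f : Θ → ∀ n, (Fin n → X) → ℝ≥0∞) (l : ∀ n, (Fin n → X) → ℝ≥0∞)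
    (ψ : ∀ n, (Fin n → X) → ℝ≥0∞) : ℝ≥0∞ :=
  if Pfin π₂ μ f ψ = 1 then
    ∑' n : ℕ, ∫⁻ x, s ψ (n + 1) x *
      (c * ((n : ℝ≥0∞) + 1) * fbar π₂ f (n + 1) x + l (n + 1) x) ∂pm μ (n + 1)
  else ⊤

/-- `R_N(ψ)`, the risk of `ψ` truncated at `N`. -/
noncomputable def RN (π₂ : Measure Θ) (μ : Measure X) (c : ℝ≥0∞)
    (f : Θ → ∀ n, (Fin n → X) → ℝ≥0∞) (l : ∀ n, (Fin n → X) → ℝ≥0∞)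
    (N : ℕ) (ψ : ∀ n, (Fin n → X) → ℝ≥0∞) : ℝ≥0∞ :=
  (∑ n ∈ Finset.range (N - 1), ∫⁻ x, s ψ (n + 1) x *
      (c * ((n : ℝ≥0∞) + 1) * fbar π₂ f (n + 1) x + l (n + 1) x) ∂pm μ (n + 1)) +
  ∫⁻ x, t ψ N x * (c * (N : ℝ≥0∞) * fbar π₂ f N x + l N x) ∂pm μ N

/-- `Vₙᴺ`, defined backwards from `V_Nᴺ = l_N` by `Vₙᴺ = min{lₙ, Qₙᴺ}`. -/
noncomputable def V (μ : Measure X) (c : ℝ≥0∞) (fb l : ∀ n, (Fin n → X) → ℝ≥0∞)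
    (N n : ℕ) (x : Fin n → X) : ℝ≥0∞ :=
  if h : n < N then
    min (l n x) (c * fb n x + ∫⁻ y, V μ c fb l N (n + 1) (Fin.snoc x y) ∂μ)
  else l n x
termination_by N - n
decreasing_by omega

/-- `Qₙᴺ = c fⁿ + ∫ Vₙ₊₁ᴺ(⋅,y) dμ(y)`. -/
noncomputable def Q (μ : Measure X) (c : ℝ≥0∞) (fb l : ∀ n, (Fin n → X) → ℝ≥0∞)
    (N n : ℕ) (x : Fin n → X) : ℝ≥0∞ :=
  c * fb n x + ∫⁻ y, V μ c fb l N (n + 1) (Fin.snoc x y) ∂μ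

/-- `Vₙ = lim_{N→∞} Vₙᴺ` (the sequence is nonincreasing in `N`, so the limit is the inf). -/
noncomputable def Vlim (μ : Measure X) (c : ℝ≥0∞) (fb l : ∀ n, (Fin n → X) → ℝ≥0∞)
    (n : ℕ) (x : Fin n → X) : ℝ≥0∞ :=
  ⨅ N, V μ c fb l N n x

/-- `Qₙ = lim_{N→∞} Qₙᴺ = c fⁿ + ∫ Vₙ₊₁(⋅,y) dμ(y)`. -/
noncomputable def Qlim (μ : Measure X) (c : ℝ≥0∞) (fb l : ∀ n, (Fin n → X) → ℝ≥0∞)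
    (n : ℕ) (x : Fin n → X) : ℝ≥0∞ :=
  c * fb n x + ∫⁻ y, Vlim μ c fb l (n + 1) (Fin.snoc x y) ∂μ

end SDP

namespace SDP

section ContinuationProbability

variable {X : Type*}

lemma t_succ_snoc (ψ : ∀ n, (Fin n → X) → ℝ≥0∞) (k : ℕ) (x : Fin (k + 1) → X) (y : X) :
    t ψ (k + 2) (Fin.snoc x y) = t ψ (k + 1) x * (1 - ψ (k + 1) x) := by
  simp [t]

lemma t_le_one (ψ : ∀ n, (Fin n → X) → ℝ≥0∞) : ∀ (n : ℕ) (x : Fin n → X), t ψ n x ≤ 1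
  | 0, _ => by simp [t]
  | 1, _ => by simp [t]
  | n + 2, x => by
    simpa [t] using mul_le_mul' (t_le_one ψ (n + 1) (Fin.init x))
      (tsub_le_self (a := (1 : ℝ≥0∞)) (b := ψ (n + 1) (Fin.init x)))

lemma t_congr {ψ φ : ∀ n, (Fin n → X) → ℝ≥0∞} :
    ∀ (n : ℕ), (∀ m < n, ψ m = φ m) → t ψ n = t φ n
  | 0, _ => rfl
  | 1, _ => rfl
  | n + 2, h => by
    funext x
    simp only [t]
    rw [t_congr (n + 1) fun m hm => h m (by omega), h (n + 1) (by omega)]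

end ContinuationProbability

section Measurability

variable {X : Type*} [MeasurableSpace X]

lemma measurable_snoc (n : ℕ) :
    Measurable fun p : (Fin n → X) × X => (Fin.snoc p.1 p.2 : Fin (n + 1) → X) := by
  refine measurable_pi_iff.2 fun i => ?_
  induction i using Fin.lastCases with
  | last => simpa using measurable_snd
  | cast j => simpa [Function.comp_def] using
    ((measurable_pi_apply j).comp measurable_fst : Measurable fun p : (Fin n → X) × X => p.1 j)

lemma measurable_snoc_left (n : ℕ) (x : Fin n → X) :
    Measurable fun y : X => (Fin.snoc x y : Fin (n + 1) → X) :=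
  (measurable_snoc n).comp measurable_prodMk_left

lemma measurable_lintegral_snoc (μ : Measure X) [SFinite μ] {n : ℕ}
    {g : (Fin (n + 1) → X) → ℝ≥0∞} (hg : Measurable g) :
    Measurable fun x : Fin n → X => ∫⁻ y, g (Fin.snoc x y) ∂μ :=
  (hg.comp (measurable_snoc n)).lintegral_prod_right'

lemma lintegral_pm_succ (μ : Measure X) [SigmaFinite μ] {n : ℕ}
    {g : (Fin (n + 1) → X) → ℝ≥0∞} (hg : Measurable g) :
    ∫⁻ z, g z ∂pm μ (n + 1) = ∫⁻ x, ∫⁻ y, g (Fin.snoc x y) ∂μ ∂pm μ n := by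
  have h := (measurePreserving_piFinSuccAbove (fun _ : Fin (n + 1) => μ) (Fin.last n)).symm
  unfold pm
  rw [← h.lintegral_comp hg, lintegral_prod_symm'
    (fun z => g ((MeasurableEquiv.piFinSuccAbove (fun _ => X) (Fin.last n)).symm z))
    (hg.comp h.measurable)]
  simp [MeasurableEquiv.piFinSuccAbove, Fin.insertNthEquiv]

instance (μ : Measure X) [SigmaFinite μ] (n : ℕ) : SigmaFinite (pm μ n) := by
  unfold pm; infer_instance

lemma measurable_t {ψ : ∀ n, (Fin n → X) → ℝ≥0∞} (hψ : IsStoppingRule ψ) :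
    ∀ n, Measurable (t ψ n)
  | 0 => by exact measurable_const
  | 1 => by exact measurable_const
  | n + 2 => by
    have hinit : Measurable (Fin.init : (Fin (n + 2) → X) → Fin (n + 1) → X) :=
      measurable_pi_iff.2 fun i => measurable_pi_apply _
    exact ((measurable_t hψ (n + 1)).comp hinit).mul
      (measurable_const.sub ((hψ.1 (n + 1)).comp hinit))

lemma measurable_s {ψ : ∀ n, (Fin n → X) → ℝ≥0∞} (hψ : IsStoppingRule ψ) (n : ℕ) :
    Measurable (s ψ n) :=
  (measurable_t hψ n).mul (hψ.1 n)

end Measurability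

section ValueFunction

variable {X : Type*} [MeasurableSpace X] (μ : Measure X) (c : ℝ≥0∞)
  (fb l : ∀ n, (Fin n → X) → ℝ≥0∞)

lemma V_of_lt {N n : ℕ} (h : n < N) (x : Fin n → X) :
    V μ c fb l N n x = min (l n x) (Q μ c fb l N n x) := by
  rw [V, dif_pos h, Q]

lemma V_of_le {N n : ℕ} (h : N ≤ n) (x : Fin n → X) : V μ c fb l N n x = l n x := by
  rw [V, dif_neg (by omega)]

lemma V_le (N n : ℕ) (x : Fin n → X) : V μ c fb l N n x ≤ l n x := by
  rcases lt_or_ge n N with h | h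
  · exact (V_of_lt μ c fb l h x).trans_le (min_le_left _ _)
  · exact (V_of_le μ c fb l h x).le

lemma Vlim_le (n : ℕ) (x : Fin n → X) : Vlim μ c fb l n x ≤ l n x :=
  (iInf_le _ 0).trans (V_le μ c fb l 0 n x)

lemma min_Qlim_le_Vlim (n : ℕ) (x : Fin n → X) :
    min (l n x) (Qlim μ c fb l n x) ≤ Vlim μ c fb l n x := by
  refine le_iInf fun N => ?_
  rcases lt_or_ge n N with h | h
  · rw [V_of_lt μ c fb l h]
    refine min_le_min le_rfl ?_
    unfold Q Qlim
    gcongr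
    exact iInf_le _ _
  · rw [V_of_le μ c fb l h]
    exact min_le_left _ _

variable {fb l} [SigmaFinite μ]

lemma measurable_V (hfb : ∀ n, Measurable (fb n)) (hl : ∀ n, Measurable (l n)) (N n : ℕ) :
    Measurable (V μ c fb l N n) := by
  rcases le_or_gt N n with h | h
  · rw [funext (V_of_le μ c fb l h)]
    exact hl n
  · induction h.le using Nat.decreasingInduction with
    | self => exact absurd h (lt_irrefl _)
    | of_succ k hk ih =>
      have hV : Measurable (V μ c fb l N (k + 1)) := by
        rcases lt_or_ge (k + 1) N with h' | h'
        · exact ih h'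
        · rw [funext (V_of_le μ c fb l h')]
          exact hl _
      rw [funext (V_of_lt μ c fb l h)]
      exact (hl k).min (((hfb k).const_mul c).add (measurable_lintegral_snoc μ hV))

lemma measurable_Vlim (hfb : ∀ n, Measurable (fb n)) (hl : ∀ n, Measurable (l n)) (n : ℕ) :
    Measurable (Vlim μ c fb l n) :=
  Measurable.iInf fun N => measurable_V μ c hfb hl N n

lemma measurable_Qlim (hfb : ∀ n, Measurable (fb n)) (hl : ∀ n, Measurable (l n)) (n : ℕ) :
    Measurable (Qlim μ c fb l n) :=
  ((hfb n).const_mul c).add (measurable_lintegral_snoc μ (measurable_Vlim μ c hfb hl (n + 1)))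

end ValueFunction

section PartialRisk

variable {X : Type*} [MeasurableSpace X]

/-- The risk of using `ψ` through stage `k` and then paying the terminal cost `g` on the paths
which have not been stopped, the observation at stage `k + 1` being taken. -/
noncomputable def partialRisk (μ : Measure X) (c : ℝ≥0∞) (fb l : ∀ n, (Fin n → X) → ℝ≥0∞)
    (ψ : ∀ n, (Fin n → X) → ℝ≥0∞) (k : ℕ) (g : (Fin (k + 1) → X) → ℝ≥0∞) : ℝ≥0∞ :=
  (∑ n ∈ Finset.range k, ∫⁻ x, s ψ (n + 1) x *
      (c * ((n : ℝ≥0∞) + 1) * fb (n + 1) x + l (n + 1) x) ∂pm μ (n + 1)) +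
  ∫⁻ x, t ψ (k + 1) x * (c * ((k : ℝ≥0∞) + 1) * fb (k + 1) x + g x) ∂pm μ (k + 1)

/-- The conditional cost at stage `n` when stopping with probability `ψ n` and otherwise
continuing at cost `Qlim`. -/
noncomputable def stageCost (μ : Measure X) (c : ℝ≥0∞) (fb l : ∀ n, (Fin n → X) → ℝ≥0∞)
    (ψ : ∀ n, (Fin n → X) → ℝ≥0∞) (n : ℕ) (x : Fin n → X) : ℝ≥0∞ :=
  ψ n x * l n x + (1 - ψ n x) * Qlim μ c fb l n x

variable {μ : Measure X} {c : ℝ≥0∞} {fb l ψ : ∀ n, (Fin n → X) → ℝ≥0∞}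

lemma partialRisk_mono_ae {k : ℕ} {g h : (Fin (k + 1) → X) → ℝ≥0∞}
    (hgh : ∀ᵐ x ∂pm μ (k + 1), 0 < t ψ (k + 1) x → g x ≤ h x) :
    partialRisk μ c fb l ψ k g ≤ partialRisk μ c fb l ψ k h := by
  refine add_le_add le_rfl (lintegral_mono_ae ?_)
  filter_upwards [hgh] with x hx
  rcases eq_or_ne (t ψ (k + 1) x) 0 with h0 | h0
  · simp [h0]
  · gcongr
    exact hx (pos_iff_ne_zero.2 h0)

lemma partialRisk_mono {k : ℕ} {g h : (Fin (k + 1) → X) → ℝ≥0∞} (hgh : ∀ x, g x ≤ h x) :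
    partialRisk μ c fb l ψ k g ≤ partialRisk μ c fb l ψ k h :=
  partialRisk_mono_ae (.of_forall fun x _ => hgh x)

lemma partialRisk_zero (g : (Fin 1 → X) → ℝ≥0∞) :
    partialRisk μ c fb l ψ 0 g = ∫⁻ x, (c * fb 1 x + g x) ∂pm μ 1 := by
  simp [partialRisk, t]

lemma partialRisk_congr {φ : ∀ n, (Fin n → X) → ℝ≥0∞} {k : ℕ} (h : ∀ m < k + 1, ψ m = φ m)
    (g : (Fin (k + 1) → X) → ℝ≥0∞) :
    partialRisk μ c fb l ψ k g = partialRisk μ c fb l φ k g := by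
  unfold partialRisk
  rw [t_congr (k + 1) h]
  congr 1
  refine Finset.sum_congr rfl fun n hn => ?_
  have hn' := Finset.mem_range.1 hn
  unfold s
  rw [t_congr (n + 1) fun m hm => h m (by omega), h (n + 1) (by omega)]

lemma min_le_mul_add_mul {p : ℝ≥0∞} (hp : p ≤ 1) (a b : ℝ≥0∞) :
    min a b ≤ p * a + (1 - p) * b := calc
  min a b = (p + (1 - p)) * min a b := by rw [add_tsub_cancel_of_le hp, one_mul]
  _ = p * min a b + (1 - p) * min a b := add_mul _ _ _
  _ ≤ p * a + (1 - p) * b := by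
    gcongr
    · exact min_le_left _ _
    · exact min_le_right _ _

variable [SigmaFinite μ] (hfb : ∀ n, Measurable (fb n)) (hl : ∀ n, Measurable (l n))
  (hcons : ∀ n (x : Fin n → X), ∫⁻ y, fb (n + 1) (Fin.snoc x y) ∂μ = fb n x)

include hfb hl hcons in
lemma partialRisk_succ (hψ : IsStoppingRule ψ) (k : ℕ) {h : (Fin (k + 2) → X) → ℝ≥0∞}
    (hh : Measurable h) :
    partialRisk μ c fb l ψ (k + 1) h = partialRisk μ c fb l ψ k fun x =>
      ψ (k + 1) x * l (k + 1) x +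
        (1 - ψ (k + 1) x) * (c * fb (k + 1) x + ∫⁻ y, h (Fin.snoc x y) ∂μ) := by
  unfold partialRisk
  rw [Finset.sum_range_succ, add_assoc]
  congr 1
  have hm := measurable_t hψ (k + 2)
  have hf2 := hfb (k + 2)
  have hs := measurable_s hψ (k + 1)
  have hf1 := hfb (k + 1)
  have hl1 := hl (k + 1)
  rw [lintegral_pm_succ (n := k + 1) μ (by fun_prop), ← lintegral_add_left (by fun_prop)]
  refine lintegral_congr fun x => ?_
  have hsn := measurable_snoc_left (k + 1) x
  simp_rw [t_succ_snoc]
  rw [lintegral_const_mul _ (by fun_prop), lintegral_add_left (by fun_prop),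
    lintegral_const_mul _ (by fun_prop), hcons]
  have h1 : ψ (k + 1) x + (1 - ψ (k + 1) x) = 1 := add_tsub_cancel_of_le (hψ.2 _ _)
  unfold s
  generalize ψ (k + 1) x = p at *
  generalize 1 - p = q at *
  generalize (∫⁻ y, h (Fin.snoc x y) ∂μ) = H
  push_cast
  calc _ = t ψ (k + 1) x * (c * (k + 1) * fb (k + 1) x * (p + q) + (p * l (k + 1) x +
          q * (c * fb (k + 1) x + H))) := by ring
    _ = _ := by rw [h1, mul_one]

include hfb hl hcons in
lemma partialRisk_V_le (hψ : IsStoppingRule ψ) {N k : ℕ} (hk : k ≤ N) :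
    partialRisk μ c fb l ψ k (V μ c fb l (N + 1) (k + 1)) ≤
      partialRisk μ c fb l ψ N (l (N + 1)) := by
  induction hk using Nat.decreasingInduction with
  | self => exact partialRisk_mono fun x => V_le _ _ _ _ _ _ _
  | of_succ k hk ih =>
    refine le_trans ?_ ih
    rw [partialRisk_succ hfb hl hcons hψ k (measurable_V μ c hfb hl _ _)]
    refine partialRisk_mono fun x => ?_
    rw [V_of_lt μ c fb l (by omega)]
    exact min_le_mul_add_mul (hψ.2 _ _) _ _

include hfb hl hcons in
lemma partialRisk_succ_Vlim (hψ : IsStoppingRule ψ) (k : ℕ) :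
    partialRisk μ c fb l ψ (k + 1) (Vlim μ c fb l (k + 2)) =
      partialRisk μ c fb l ψ k (stageCost μ c fb l ψ (k + 1)) :=
  partialRisk_succ hfb hl hcons hψ k (measurable_Vlim μ c hfb hl _)

include hfb hl hcons in
lemma partialRisk_succ_Vlim_le (hψ : IsStoppingRule ψ) {k : ℕ}
    (hopt : ∀ m, k ≤ m → ∀ᵐ x ∂pm μ (m + 1), 0 < t ψ (m + 1) x →
      stageCost μ c fb l ψ (m + 1) x ≤ min (l (m + 1) x) (Qlim μ c fb l (m + 1) x))
    {m : ℕ} (hm : k ≤ m) :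
    partialRisk μ c fb l ψ (m + 1) (Vlim μ c fb l (m + 2)) ≤
      partialRisk μ c fb l ψ k fun x => min (l (k + 1) x) (Qlim μ c fb l (k + 1) x) := by
  induction m, hm using Nat.le_induction with
  | base =>
    rw [partialRisk_succ_Vlim hfb hl hcons hψ]
    exact partialRisk_mono_ae (hopt k le_rfl)
  | succ m hm ih =>
    refine le_trans ?_ ih
    rw [partialRisk_succ_Vlim hfb hl hcons hψ]
    exact (partialRisk_mono_ae (hopt (m + 1) (by omega))).trans
      (partialRisk_mono fun x => min_Qlim_le_Vlim _ _ _ _ _ _)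

include hfb hcons in
lemma sum_lintegral_s_add_lintegral_t (hψ : IsStoppingRule ψ) (hone : ∫⁻ x, fb 1 x ∂pm μ 1 = 1)
    (k : ℕ) :
    ∑ n ∈ Finset.range k, ∫⁻ x, s ψ (n + 1) x * fb (n + 1) x ∂pm μ (n + 1) +
      ∫⁻ x, t ψ (k + 1) x * fb (k + 1) x ∂pm μ (k + 1) = 1 := by
  suffices h : partialRisk μ 0 fb fb ψ k (fb (k + 1)) = 1 by simpa [partialRisk] using h
  induction k with
  | zero => simpa [partialRisk_zero] using hone
  | succ k ih =>
    rw [partialRisk_succ hfb hfb hcons hψ k (hfb _)]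
    refine Eq.trans ?_ ih
    congr 1
    funext x
    rw [hcons, zero_mul, zero_add, ← add_mul, add_tsub_cancel_of_le (hψ.2 _ _), one_mul]

end PartialRisk

section Risk

variable {Θ X : Type*} [MeasurableSpace Θ] [MeasurableSpace X] {μ : Measure X}
  {π : Measure Θ} {f : Θ → ∀ n, (Fin n → X) → ℝ≥0∞} {c : ℝ≥0∞}
  {l ψ : ∀ n, (Fin n → X) → ℝ≥0∞}

lemma RN_succ (N : ℕ) :
    RN π μ c f l (N + 1) ψ = partialRisk μ c (fbar π f) l ψ N (l (N + 1)) := by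
  simp [RN, partialRisk]

lemma measurable_fbar [SFinite π] (hf : IsDensityFamily μ f) (n : ℕ) : Measurable (fbar π f n) :=
  (hf.1 n).lintegral_prod_left'

variable [SigmaFinite μ]

lemma lintegral_fbar_snoc [SFinite π] (hf : IsDensityFamily μ f) (n : ℕ) (x : Fin n → X) :
    ∫⁻ y, fbar π f (n + 1) (Fin.snoc x y) ∂μ = fbar π f n x := by
  have hm : Measurable fun p : X × Θ => f p.2 (n + 1) (Fin.snoc x p.1) :=
    (hf.1 (n + 1)).comp
      (measurable_snd.prodMk ((measurable_snoc_left n x).comp measurable_fst))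
  unfold fbar
  rw [lintegral_lintegral_swap hm.aemeasurable]
  exact lintegral_congr fun θ => hf.2.2.2 θ n x

lemma lintegral_fbar [IsProbabilityMeasure π] (hf : IsDensityFamily μ f) (n : ℕ) :
    ∫⁻ x, fbar π f n x ∂pm μ n = 1 := by
  have hm : Measurable fun p : (Fin n → X) × Θ => f p.2 n p.1 := (hf.1 n).comp measurable_swap
  unfold fbar
  rw [lintegral_lintegral_swap hm.aemeasurable]
  simp [hf.2.2.1]

lemma PtauEq_eq [SFinite π] (hf : IsDensityFamily μ f) (hψ : IsStoppingRule ψ) (n : ℕ) :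
    PtauEq π μ f ψ n = ∫⁻ x, s ψ n x * fbar π f n x ∂pm μ n := by
  unfold PtauEq fbar
  have h1 := hf.1 n
  have hm : Measurable fun p : Θ × (Fin n → X) => s ψ n p.2 * f p.1 n p.2 :=
    ((measurable_s hψ n).comp measurable_snd).mul h1
  rw [lintegral_lintegral_swap hm.aemeasurable]
  exact lintegral_congr fun x => lintegral_const_mul _ (h1.comp measurable_prodMk_right)

lemma partialRisk_Vlim_le_R [SFinite π] (hf : IsDensityFamily μ f) (hl : ∀ n, Measurable (l n))
    (hψ : IsStoppingRule ψ)
    (htrunc : Tendsto (fun N => RN π μ c f l N ψ) atTop (nhds (R π μ c f l ψ))) (k : ℕ) :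
    partialRisk μ c (fbar π f) l ψ k (Vlim μ c (fbar π f) l (k + 1)) ≤ R π μ c f l ψ := by
  refine ge_of_tendsto ((tendsto_add_atTop_iff_nat 1).2 htrunc) ?_
  filter_upwards [eventually_ge_atTop k] with N hN
  rw [RN_succ]
  exact (partialRisk_mono fun x => iInf_le _ _).trans
    (partialRisk_V_le (measurable_fbar hf) hl (lintegral_fbar_snoc hf) hψ hN)

lemma R_le_of_partialRisk_le [IsProbabilityMeasure π] (hf : IsDensityFamily μ f) (hc : 0 < c)
    (hc' : c ≠ ⊤) (hψ : IsStoppingRule ψ) {k : ℕ} {B : ℝ≥0∞}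
    {g : ∀ n, (Fin n → X) → ℝ≥0∞}
    (hB : ∀ m, k ≤ m → partialRisk μ c (fbar π f) l ψ m (g (m + 1)) ≤ B) :
    R π μ c f l ψ ≤ B := by
  rcases eq_or_ne B ⊤ with rfl | hBtop
  · exact le_top
  have hbound : ∀ m, k ≤ m → ∫⁻ x, t ψ (m + 1) x * fbar π f (m + 1) x ∂pm μ (m + 1) ≤
      B / c / ((m + 1 : ℕ) : ℝ≥0∞) := by
    intro m hm
    have hm1 := measurable_t hψ (m + 1)
    have hm2 := measurable_fbar (π := π) hf (m + 1)
    rw [ENNReal.le_div_iff_mul_le (Or.inl (by simp)) (Or.inl (ENNReal.natCast_ne_top _)),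
      ENNReal.le_div_iff_mul_le (Or.inl hc.ne') (Or.inl hc'), mul_assoc, mul_comm,
      ← lintegral_const_mul _ (by fun_prop)]
    refine (le_add_self.trans' (lintegral_mono fun x => ?_)).trans (hB m hm)
    calc ((m + 1 : ℕ) : ℝ≥0∞) * c * (t ψ (m + 1) x * fbar π f (m + 1) x)
        = t ψ (m + 1) x * (c * ((m : ℝ≥0∞) + 1) * fbar π f (m + 1) x) := by push_cast; ring
      _ ≤ _ := by gcongr; exact le_self_add
  have htend : Tendsto
      (fun m => ∫⁻ x, t ψ (m + 1) x * fbar π f (m + 1) x ∂pm μ (m + 1)) atTop (nhds 0) := by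
    have h0 : Tendsto (fun m : ℕ => B / c / (m : ℝ≥0∞)) atTop (nhds 0) := by
      simpa using ENNReal.Tendsto.const_div ENNReal.tendsto_nat_nhds_top
        (Or.inr (ENNReal.div_ne_top hBtop hc.ne'))
    refine tendsto_of_tendsto_of_tendsto_of_le_of_le' tendsto_const_nhds
      ((tendsto_add_atTop_iff_nat 1).2 h0) (.of_forall fun _ => zero_le) ?_
    filter_upwards [eventually_ge_atTop k] with m hm using hbound m hm
  have hP : Pfin π μ f ψ = 1 := by
    have h1 := (ENNReal.tendsto_nat_tsum fun n => PtauEq π μ f ψ (n + 1)).add htend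
    rw [add_zero] at h1
    refine tendsto_nhds_unique h1 (tendsto_const_nhds.congr fun m => ?_)
    simp_rw [PtauEq_eq hf hψ]
    exact (sum_lintegral_s_add_lintegral_t (measurable_fbar hf) (lintegral_fbar_snoc hf) hψ
      (lintegral_fbar hf 1) m).symm
  rw [R, if_pos hP]
  refine le_of_tendsto (ENNReal.tendsto_nat_tsum _) ?_
  filter_upwards [eventually_ge_atTop k] with m hm
  exact le_self_add.trans (hB m hm)

lemma R_le_partialRisk_min [IsProbabilityMeasure π] (hf : IsDensityFamily μ f) (hc : 0 < c)
    (hc' : c ≠ ⊤) (hl : ∀ n, Measurable (l n)) (hψ : IsStoppingRule ψ) (k : ℕ)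
    (hopt : ∀ m, k ≤ m → ∀ᵐ x ∂pm μ (m + 1), 0 < t ψ (m + 1) x →
      stageCost μ c (fbar π f) l ψ (m + 1) x ≤
        min (l (m + 1) x) (Qlim μ c (fbar π f) l (m + 1) x)) :
    R π μ c f l ψ ≤ partialRisk μ c (fbar π f) l ψ k fun x =>
      min (l (k + 1) x) (Qlim μ c (fbar π f) l (k + 1) x) := by
  refine R_le_of_partialRisk_le (k := k + 1) (g := fun n => Vlim μ c (fbar π f) l n)
    hf hc hc' hψ fun m hm => ?_
  obtain ⟨m, rfl⟩ : ∃ j, m = j + 1 := ⟨m - 1, by omega⟩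
  exact partialRisk_succ_Vlim_le (measurable_fbar hf) hl (lintegral_fbar_snoc hf) hψ hopt
    (by omega)

/-- The rule which follows `ψ` before stage `k` and from then on stops as soon as stopping is not
more expensive than continuing. -/
noncomputable def optimalFrom (l q ψ : ∀ n, (Fin n → X) → ℝ≥0∞) (k n : ℕ) :
    (Fin n → X) → ℝ≥0∞ :=
  if n < k then ψ n else {x | l n x ≤ q n x}.indicator 1

lemma isStoppingRule_optimalFrom {q : ∀ n, (Fin n → X) → ℝ≥0∞} (hl : ∀ n, Measurable (l n))
    (hq : ∀ n, Measurable (q n)) (hψ : IsStoppingRule ψ) (k : ℕ) :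
    IsStoppingRule (optimalFrom l q ψ k) := by
  refine ⟨fun n => ?_, fun n x => ?_⟩ <;> unfold optimalFrom <;> split_ifs
  · exact hψ.1 n
  · exact measurable_one.indicator (measurableSet_le (hl n) (hq n))
  · exact hψ.2 n x
  · exact Set.indicator_le_self' (fun _ _ => zero_le) x

lemma R_optimalFrom_le [IsProbabilityMeasure π] (hf : IsDensityFamily μ f) (hc : 0 < c)
    (hc' : c ≠ ⊤) (hl : ∀ n, Measurable (l n)) (hψ : IsStoppingRule ψ) (k : ℕ) :
    R π μ c f l (optimalFrom l (Qlim μ c (fbar π f) l) ψ (k + 1)) ≤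
      partialRisk μ c (fbar π f) l ψ k fun x =>
        min (l (k + 1) x) (Qlim μ c (fbar π f) l (k + 1) x) := by
  have hq := measurable_Qlim μ c (measurable_fbar (π := π) hf) hl
  refine (R_le_partialRisk_min hf hc hc' hl (isStoppingRule_optimalFrom hl hq hψ (k + 1)) k
    fun m hm => .of_forall fun x _ => ?_).trans_eq
      (partialRisk_congr (fun m hm => if_pos hm) _)
  have hmk : ¬ m + 1 < k + 1 := by omega
  rcases le_or_gt (l (m + 1) x) (Qlim μ c (fbar π f) l (m + 1) x) with h | h
  · simp [stageCost, optimalFrom, hmk, h]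
  · simp [stageCost, optimalFrom, hmk, h.not_ge, h.le]

end Risk

section StageCost

variable {p a b : ℝ≥0∞}

lemma eq_one_of_stageCost_le (hp : p ≤ 1) (hab : a < b) (h : p * a + (1 - p) * b ≤ a) : p = 1 := by
  by_contra hne
  have h0 : 1 - p ≠ 0 := (tsub_pos_of_lt (lt_of_le_of_ne hp hne)).ne'
  have h1 : 1 - p ≠ ⊤ := ENNReal.sub_ne_top one_ne_top
  have hlt : (1 - p) * a < (1 - p) * b := (ENNReal.mul_lt_mul_iff_right h0 h1).2 hab
  have hfin : p * a ≠ ⊤ := ENNReal.mul_ne_top (hp.trans_lt one_lt_top).ne hab.ne_top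
  refine (h.trans_lt' ?_).false
  calc a = p * a + (1 - p) * a := by rw [← add_mul, add_tsub_cancel_of_le hp, one_mul]
    _ < p * a + (1 - p) * b := ENNReal.add_lt_add_left hfin hlt

lemma eq_zero_of_stageCost_le (hp : p ≤ 1) (hba : b < a) (h : p * a + (1 - p) * b ≤ b) :
    p = 0 := by
  have hp' : 1 - (1 - p) = p := ENNReal.sub_sub_cancel one_ne_top hp
  have h1 := eq_one_of_stageCost_le (p := 1 - p) tsub_le_self hba (by rwa [hp', add_comm])
  rw [← hp', h1, tsub_self]

end StageCost

end SDP

open SDP MeasureTheory ENNReal Filter in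
/-- Bayesian reformulation (`π₁ = π₂ = π`): if every stopping rule is
truncatable and `𝓕` is the set of all stopping rules, then `R(ψ) = inf_{ψ'∈𝓕} R(ψ')` iff
`1{Rₙ < qₙ} ≤ ψₙ ≤ 1{Rₙ ≤ qₙ}` a.e. w.r.t. `fⁿ·μⁿ` on `Tₙ^ψ` for every `n ≥ 1`, where
`Rₙ = lₙ/fⁿ` is the posterior risk and `qₙ = Qₙ/fⁿ`. -/
theorem statement_15
    {Θ X D : Type*} [MeasurableSpace Θ] [MeasurableSpace X] [MeasurableSpace D]
    (μ : Measure X) [SigmaFinite μ]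
    (π : Measure Θ) [IsProbabilityMeasure π]
    (f : Θ → ∀ n, (Fin n → X) → ℝ≥0∞) (hf : IsDensityFamily μ f)
    (w : Θ → D → ℝ≥0∞) (hw : Measurable (Function.uncurry w))
    (δB : ∀ n, (Fin n → X) → D) (hδB : IsDecisionRule δB)
    (hBayes : ∀ n (d : D), ∀ᵐ x ∂pm μ n,
      ∫⁻ θ, w θ (δB n x) * f θ n x ∂π ≤ ∫⁻ θ, w θ d * f θ n x ∂π)
    (l : ∀ n, (Fin n → X) → ℝ≥0∞)
    (hl : ∀ n x, l n x = ∫⁻ θ, w θ (δB n x) * f θ n x ∂π)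
    (hl1 : ∫⁻ x, l 1 x ∂pm μ 1 < ⊤)
    (c : ℝ≥0∞) (hc : 0 < c) (hc' : c ≠ ⊤)
    -- every stopping rule is truncatable
    (htrunc : ∀ ψ : ∀ n, (Fin n → X) → ℝ≥0∞, IsStoppingRule ψ →
      Tendsto (fun N => RN π μ c f l N ψ) atTop (nhds (R π μ c f l ψ)))
    (ψ : ∀ n, (Fin n → X) → ℝ≥0∞) (hψ : IsStoppingRule ψ) :
    R π μ c f l ψ =
        (⨅ (ψ' : ∀ n, (Fin n → X) → ℝ≥0∞) (_ : IsStoppingRule ψ'), R π μ c f l ψ') ↔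
      ∀ n : ℕ, 1 ≤ n →
        ∀ᵐ x ∂(pm μ n).withDensity (fbar π f n), 0 < t ψ n x →
          ({y : Fin n → X |
              l n y / fbar π f n y < Qlim μ c (fbar π f) l n y / fbar π f n y}.indicator
                1 x ≤ ψ n x ∧
            ψ n x ≤ {y : Fin n → X |
              l n y / fbar π f n y ≤ Qlim μ c (fbar π f) l n y / fbar π f n y}.indicator
                1 x) := by
  have hlm : ∀ n, Measurable (l n) := by
    intro n
    rw [funext (hl n)]
    have hmw : Measurable fun q : Θ × (Fin n → X) => w q.1 (δB n q.2) * f q.1 n q.2 :=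
      (hw.comp (measurable_fst.prodMk ((hδB n).comp measurable_snd))).mul (hf.1 n)
    exact hmw.lintegral_prod_left'
  have hfb := measurable_fbar (π := π) hf
  have hcons := lintegral_fbar_snoc (π := π) hf
  have hl0 : ∀ n x, fbar π f n x = 0 → l n x = 0 := by
    intro n x h
    have hm : Measurable fun θ => f θ n x := (hf.1 n).comp measurable_prodMk_right
    have h0 := (lintegral_eq_zero_iff hm).1 h
    rw [hl, ← lintegral_zero (μ := π)]
    refine lintegral_congr_ae ?_
    filter_upwards [h0] with θ hθ
    simp [show f θ n x = 0 from hθ]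
  have hQ0 : ∀ n x, fbar π f n x = 0 → Qlim μ c (fbar π f) l n x = 0 := by
    intro n x h
    have h0 := (lintegral_eq_zero_iff ((hfb (n + 1)).comp (measurable_snoc_left n x))).1
      ((hcons n x).trans h)
    rw [Qlim, h, mul_zero, zero_add, ← lintegral_zero (μ := μ)]
    refine lintegral_congr_ae ?_
    filter_upwards [h0] with y hy
    exact le_zero_iff.1 ((Vlim_le μ c _ l _ _).trans_eq (hl0 _ _ hy))
  have hlow : ∀ φ, IsStoppingRule φ → ∀ k,
      partialRisk μ c (fbar π f) l φ k (Vlim μ c (fbar π f) l (k + 1)) ≤ R π μ c f l φ :=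
    fun φ hφ k => partialRisk_Vlim_le_R hf hlm hφ (htrunc φ hφ) k
  have hmono : ∀ φ k, (partialRisk μ c (fbar π f) l φ k fun x =>
      min (l (k + 1) x) (Qlim μ c (fbar π f) l (k + 1) x)) ≤
      partialRisk μ c (fbar π f) l φ k (Vlim μ c (fbar π f) l (k + 1)) :=
    fun φ k => partialRisk_mono fun x => min_Qlim_le_Vlim _ _ _ _ _ _
  have hfin : ∀ n, ∀ᵐ x ∂pm μ n, fbar π f n x < ⊤ := fun n =>
    ae_lt_top (hfb n) (by simp [lintegral_fbar hf])
  constructor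
  · intro hopt n hn
    obtain ⟨k, rfl⟩ : ∃ k, n = k + 1 := ⟨n - 1, by omega⟩
    have hbest : ∀ φ, IsStoppingRule φ → R π μ c f l ψ ≤ R π μ c f l φ :=
      fun φ hφ => hopt.trans_le (iInf₂_le φ hφ)
    have hQm := measurable_Qlim μ c hfb hlm
    have hle : ∀ k, R π μ c f l ψ ≤ partialRisk μ c (fbar π f) l ψ k fun x =>
        min (l (k + 1) x) (Qlim μ c (fbar π f) l (k + 1) x) := fun k =>
      (hbest _ (isStoppingRule_optimalFrom hlm hQm hψ (k + 1))).trans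
        (R_optimalFrom_le hf hc hc' hlm hψ k)
    have hR : R π μ c f l ψ ≠ ⊤ := by
      refine ne_top_of_le_ne_top ?_ ((hle 0).trans (partialRisk_mono fun x => min_le_left _ _))
      rw [partialRisk_zero, lintegral_add_right _ (hlm 1), lintegral_const_mul _ (hfb 1),
        lintegral_fbar hf]
      exact ENNReal.add_ne_top.2 ⟨by simpa using hc', hl1.ne⟩
    have hcost : partialRisk μ c (fbar π f) l ψ k (stageCost μ c (fbar π f) l ψ (k + 1)) ≤
        partialRisk μ c (fbar π f) l ψ k fun x =>
          min (l (k + 1) x) (Qlim μ c (fbar π f) l (k + 1) x) := by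
      rw [← partialRisk_succ_Vlim hfb hlm hcons hψ]
      exact (hlow ψ hψ (k + 1)).trans (hle k)
    have htop := ne_top_of_le_ne_top hR ((hmono ψ k).trans (hlow ψ hψ k))
    rw [partialRisk, ENNReal.add_ne_top] at htop
    rw [partialRisk, partialRisk, ENNReal.add_le_add_iff_left htop.1] at hcost
    have h1 := measurable_t hψ (k + 1)
    have h2 := hfb (k + 1)
    have h3 := hψ.1 (k + 1)
    have h4 := hlm (k + 1)
    have h5 := hQm (k + 1)
    have hae := ae_eq_of_ae_le_of_lintegral_le
      (.of_forall fun x => mul_le_mul_right (add_le_add_right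
        (min_le_mul_add_mul (hψ.2 (k + 1) x) _ _) _) _) htop.2
      (by fun_prop) hcost
    rw [ae_withDensity_iff (hfb _)]
    filter_upwards [hae, hfin (k + 1), ae_lt_top (by fun_prop) htop.2] with x hx hxf hxt hx0 htx
    have ht1 : t ψ (k + 1) x ≠ ⊤ := ((t_le_one ψ _ x).trans_lt one_lt_top).ne
    have hsum := (ENNReal.mul_right_inj htx.ne' ht1).1 hx
    have hne : c * ((k : ℝ≥0∞) + 1) * fbar π f (k + 1) x ≠ ⊤ :=
      ENNReal.mul_ne_top (ENNReal.mul_ne_top hc' (by simp)) hxf.ne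
    have heq := (ENNReal.add_right_inj hne).1 hsum
    rcases lt_trichotomy (l (k + 1) x) (Qlim μ c (fbar π f) l (k + 1) x) with h | h | h
    · rw [min_eq_left h.le] at heq
      have := eq_one_of_stageCost_le (hψ.2 _ _) h heq.ge
      rw [this]
      exact ⟨Set.indicator_le_self' (fun _ _ => zero_le) x, by
        simp [ENNReal.div_le_div_right h.le]⟩
    · simp [h, hψ.2]
    · rw [min_eq_right h.le] at heq
      have := eq_zero_of_stageCost_le (hψ.2 _ _) h heq.ge
      simp [this, Set.indicator_apply, ENNReal.div_le_div_right h.le]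
  · intro hcond
    refine le_antisymm (le_iInf₂ fun φ hφ => ?_) (iInf₂_le ψ hψ)
    have hup := R_le_partialRisk_min (π := π) hf hc hc' hlm hψ 0 fun m _ => by
      have hm := hcond (m + 1) (by omega)
      rw [ae_withDensity_iff (hfb _)] at hm
      filter_upwards [hm, hfin (m + 1)] with x hx hxf htx
      unfold stageCost
      rcases eq_or_ne (fbar π f (m + 1) x) 0 with h0 | h0
      · simp [hl0 _ _ h0, hQ0 _ _ h0]
      · obtain ⟨hx1, hx2⟩ := hx h0 htx
        have hdiv : ∀ a b, a / fbar π f (m + 1) x ≤ b / fbar π f (m + 1) x ↔ a ≤ b :=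
          fun a b => by
            rw [ENNReal.div_le_iff h0 hxf.ne, ENNReal.div_mul_cancel h0 hxf.ne]
        rcases lt_trichotomy (l (m + 1) x) (Qlim μ c (fbar π f) l (m + 1) x) with h | h | h
        · have hψ1 : ψ (m + 1) x = 1 := le_antisymm (hψ.2 _ _) (by
            
            have hlt := not_le.1 (mt (hdiv _ _).1 h.not_ge)
            simpa [hlt] using hx1)
          simp [hψ1, h.le]
        · simp [h, ← add_mul, add_tsub_cancel_of_le (hψ.2 (m + 1) x)]
        · have hψ0 : ψ (m + 1) x = 0 := by
            simpa [hdiv, h] using hx2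
          simp [hψ0, h.le]
    refine hup.trans ((hmono ψ 0).trans ?_)
    rw [partialRisk_zero]
    have := hlow φ hφ 0
    rwa [partialRisk_zero] at this
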